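/- arXiv:1106.1247 — 7 statements merged into one kernel-verified Lean document; each statement's English description precedes it below -/
import Mathlib

section
/- Let m, n ≥ 1 and let S be a ℂ-linear subspace of M_{m×n}(ℂ) every element of which has rank at most 1 (a completely separable subspace). Then either there exist a vector α ∈ ℂᵐ and a subspace B ⊆ ℂⁿ such that S = {αη* : η ∈ B}, or there exist a vector β ∈ ℂⁿ and a subspace A ⊆ ℂᵐ such that S = {ξβ* : ξ ∈ A}. -/
open Matrix Kronecker
open scoped ComplexOrder

noncomputable section

/-- Version of `Matrix.vecMulVec_zero` for rectangular matrices. -/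
theorem Matrix.vecMulVec_zero_right {m n R : Type*} [MulZeroClass R] (w : m → R) :
    vecMulVec w (0 : n → R) = 0 := by
  ext
  simp [vecMulVec_apply]

section RankLeOne

variable {m n K : Type*} [Fintype n] [Field K]

theorem Matrix.exists_eq_vecMulVec_of_rank_le_one {M : Matrix m n K} [Finite m]
    (h : M.rank ≤ 1) : ∃ u v, M = vecMulVec u v := by
  classical
  obtain ⟨w, hw⟩ := finrank_le_one_iff.mp h
  choose c hc using fun j => hw ⟨M *ᵥ Pi.single j 1, Pi.single j 1, rfl⟩
  refine ⟨w, c, ?_⟩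
  ext i j
  have := congrFun (congrArg Subtype.val (hc j)) i
  simp only [Submodule.coe_smul, Pi.smul_apply, smul_eq_mul, mulVec_single_one] at this
  rw [vecMulVec_apply, mul_comm, this]
  rfl

theorem Matrix.minor_eq_zero_of_rank_le_one {M : Matrix m n K} [Finite m] (h : M.rank ≤ 1)
    (i k : m) (j l : n) : M i j * M k l - M i l * M k j = 0 := by
  obtain ⟨u, v, rfl⟩ := exists_eq_vecMulVec_of_rank_le_one h
  simp only [vecMulVec_apply]
  ring

theorem exists_eq_smul_of_forall_mul_eq_mul {ι : Type*} {a u : ι → K} (ha : a ≠ 0)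
    (h : ∀ i k, a i * u k = a k * u i) : ∃ c : K, u = c • a := by
  obtain ⟨i, hi⟩ := Function.ne_iff.mp ha
  refine ⟨u i / a i, ?_⟩
  ext k
  have hi' : a i ≠ 0 := hi
  simp only [Pi.smul_apply, smul_eq_mul]
  field_simp
  linear_combination h i k

/-- If the sum of two matrices `vecMulVec a b`, `M` of rank at most one has rank at most one,
then `M` shares its column space or its row space with `vecMulVec a b`. -/
theorem Matrix.exists_eq_vecMulVec_left_or_right [Finite m] {a : m → K} {b : n → K}
    (ha : a ≠ 0) (hb : b ≠ 0) {M : Matrix m n K} (hM : M.rank ≤ 1)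
    (hadd : (vecMulVec a b + M).rank ≤ 1) :
    (∃ v, M = vecMulVec a v) ∨ ∃ u, M = vecMulVec u b := by
  obtain ⟨u, v, rfl⟩ := exists_eq_vecMulVec_of_rank_le_one hM
  have key (i k : m) (j l : n) : (a i * u k - a k * u i) * (b j * v l - b l * v j) = 0 := by
    have := minor_eq_zero_of_rank_le_one hadd i k j l
    simp only [add_apply, vecMulVec_apply] at this
    linear_combination this
  by_cases h : ∀ i k, a i * u k = a k * u i
  · obtain ⟨c, rfl⟩ := exists_eq_smul_of_forall_mul_eq_mul ha h
    exact .inl ⟨c • v, by rw [smul_vecMulVec, vecMulVec_smul]⟩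
  · push Not at h
    obtain ⟨i, k, hik⟩ := h
    obtain ⟨c, rfl⟩ := exists_eq_smul_of_forall_mul_eq_mul hb fun j l =>
      sub_eq_zero.mp ((mul_eq_zero.mp (key i k j l)).resolve_left (sub_ne_zero.mpr hik))
    exact .inr ⟨c • u, by rw [smul_vecMulVec, vecMulVec_smul]⟩

/-- A subspace of matrices of rank at most one has a common column space or a common row space. -/
theorem Matrix.exists_common_left_or_right [Finite m] (S : Submodule K (Matrix m n K))
    (hS : ∀ V ∈ S, V.rank ≤ 1) :
    (∃ a, ∀ M ∈ S, ∃ v, M = vecMulVec a v) ∨ ∃ b, ∀ M ∈ S, ∃ u, M = vecMulVec u b := by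
  by_cases hbot : S = ⊥
  · exact .inl ⟨0, fun M hM => ⟨0, by simpa [hbot] using hM⟩⟩
  obtain ⟨N, hN, hN0⟩ := S.ne_bot_iff.mp hbot
  obtain ⟨a, b, rfl⟩ := exists_eq_vecMulVec_of_rank_le_one (hS N hN)
  have ha : a ≠ 0 := by rintro rfl; simp at hN0
  have hb : b ≠ 0 := by rintro rfl; exact hN0 (vecMulVec_zero_right a)
  have dich (M) (hM : M ∈ S) := exists_eq_vecMulVec_left_or_right ha hb (hS M hM)
    (hS _ (S.add_mem hN hM))
  by_contra! h
  obtain ⟨⟨P, hP, hPa⟩, Q, hQ, hQb⟩ := And.intro (h.1 a) (h.2 b)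
  obtain ⟨u, hu⟩ := (dich P hP).resolve_left (by simpa using hPa)
  obtain ⟨v, hv⟩ := (dich Q hQ).resolve_right (by simpa using hQb)
  rcases dich _ (S.add_mem hP hQ) with ⟨w, hw⟩ | ⟨w, hw⟩
  · exact hPa (w - v) (by rw [vecMulVec_sub, ← hw, ← hv, add_sub_cancel_right])
  · exact hQb (w - u) (by rw [sub_vecMulVec, ← hw, ← hu, add_sub_cancel_left])

end RankLeOne

/-- Every completely separable subspace of `M_{m×n}(ℂ)` is of the form `α ⊗ B` or `A ⊗ β`. -/
theorem stmt1 (m n : ℕ) (hm : 1 ≤ m) (hn : 1 ≤ n)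
    (S : Submodule ℂ (Matrix (Fin m) (Fin n) ℂ))
    (hS : ∀ V ∈ S, V.rank ≤ 1) :
    (∃ (α : Fin m → ℂ) (B : Submodule ℂ (Fin n → ℂ)),
        (S : Set (Matrix (Fin m) (Fin n) ℂ)) = {M | ∃ η ∈ B, M = vecMulVec α (star η)}) ∨
    (∃ (β : Fin n → ℂ) (A : Submodule ℂ (Fin m → ℂ)),
        (S : Set (Matrix (Fin m) (Fin n) ℂ)) = {M | ∃ ξ ∈ A, M = vecMulVec ξ (star β)}) := by
  rcases exists_common_left_or_right S hS with ⟨a, h⟩ | ⟨b, h⟩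
  · refine .inl ⟨a,
      { carrier := {η | vecMulVec a (star η) ∈ S}
        zero_mem' := by simp [vecMulVec_zero_right]
        add_mem' := fun {x y} hx hy => by
          simpa only [Set.mem_ofPred_eq, star_add, vecMulVec_add] using S.add_mem hx hy
        smul_mem' := fun c x hx => by
          simpa only [Set.mem_ofPred_eq, star_smul, vecMulVec_smul] using S.smul_mem _ hx }, ?_⟩
    ext M
    constructor
    · intro hM
      obtain ⟨v, rfl⟩ := h M hM
      exact ⟨star v, by simpa using hM, by rw [star_star]⟩
    · rintro ⟨η, hη, rfl⟩
      exact hη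
  · refine .inr ⟨star b,
      { carrier := {ξ | vecMulVec ξ b ∈ S}
        zero_mem' := by simp
        add_mem' := fun {x y} hx hy => by
          simpa only [Set.mem_ofPred_eq, add_vecMulVec] using S.add_mem hx hy
        smul_mem' := fun c x hx => by
          simpa only [Set.mem_ofPred_eq, smul_vecMulVec] using S.smul_mem _ hx }, ?_⟩
    ext M
    constructor
    · intro hM
      obtain ⟨u, rfl⟩ := h M hM
      exact ⟨u, hM, by rw [star_star]⟩
    · rintro ⟨ξ, hξ, rfl⟩
      rwa [star_star]

end
end

section
/- Let n ≥ 1 and let D be a ℂ-linear subspace of M_{2×n}(ℂ). Suppose the set D_1 = {V ∈ D : rank V ≤ 1} is a subspace of the form D_1 = {αη* : η ∈ B} for some nonzero α ∈ ℂ² and some subspace B ⊆ ℂⁿ. Then dim_ℂ D ≤ n. -/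
open Matrix Kronecker
open scoped ComplexOrder

noncomputable section

/-- A matrix with two rows, one of which vanishes, has rank at most one. -/
theorem rank_le_one_of_row_eq_zero {n : ℕ} (V : Matrix (Fin 2) (Fin n) ℂ) (i : Fin 2)
    (h : V i = 0) : V.rank ≤ 1 := by
  have hV : V = vecMulVec (Pi.single (1 - i) 1) (V (1 - i)) := by
    ext k l
    fin_cases i <;> fin_cases k <;> simp_all [vecMulVec_apply]
  rw [hV]
  exact rank_vecMulVec_le _ _

/-- If the rank-at-most-one matrices in `D ⊆ M_{2×n}(ℂ)` form the subspace `B ⊗ α`, then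
`dim D ≤ n`. -/
theorem stmt2 (n : ℕ) (hn : 1 ≤ n) (D : Submodule ℂ (Matrix (Fin 2) (Fin n) ℂ))
    (α : Fin 2 → ℂ) (hα : α ≠ 0) (B : Submodule ℂ (Fin n → ℂ))
    (hD1 : {V | V ∈ D ∧ V.rank ≤ 1} =
      {M : Matrix (Fin 2) (Fin n) ℂ | ∃ η ∈ B, M = vecMulVec α (star η)}) :
    Module.finrank ℂ D ≤ n := by
  obtain ⟨i, hi⟩ := Function.ne_iff.mp hα
  let row : Matrix (Fin 2) (Fin n) ℂ →ₗ[ℂ] Fin n → ℂ :=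
    { toFun := fun V => V i, map_add' := fun _ _ => rfl, map_smul' := fun _ _ => rfl }
  have hinj : Function.Injective (row ∘ₗ D.subtype) := by
    rw [injective_iff_map_eq_zero]
    rintro ⟨V, hV⟩ h
    have hrow : V i = 0 := h
    obtain ⟨η, -, rfl⟩ := hD1.subset ⟨hV, rank_le_one_of_row_eq_zero V i hrow⟩
    have hη : star η = 0 := by
      ext l
      have hl := congrFun hrow l
      rw [vecMulVec_apply] at hl
      exact (mul_eq_zero.mp hl).resolve_left hi
    ext k l
    simp [hη, vecMulVec_apply]
  simpa using LinearMap.finrank_le_finrank_of_injective hinj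

end
end

section
/- Let D be a ℂ-linear subspace of M_{2×n}(ℂ) such that D_1 = {V ∈ D : rank V ≤ 1} is a subspace of the form D_1 = {αη* : η ∈ B} for a nonzero α ∈ ℂ² and a subspace B ⊆ ℂⁿ. Let p ∈ M_n(ℂ) be the orthogonal projection onto B, and let D_2 = D ∩ D_1^⊥ (orthogonal complement with respect to the Hilbert–Schmidt inner product). Then every matrix of rank at most 1 of the form a(1_n − p) with a ∈ D_2 equals αγ* for some γ ∈ B^⊥. -/
open Matrix Kronecker
open scoped ComplexOrder

noncomputable section


/-- Orthogonal complement of a set of vectors in `ℂⁿ` w.r.t. the standard inner product. -/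
def vPerp {n : ℕ} (B : Submodule ℂ (Fin n → ℂ)) : Submodule ℂ (Fin n → ℂ) where
  carrier := {γ | ∀ η ∈ B, ∑ j, star (η j) * γ j = 0}
  add_mem' := by
    intro a b ha hb η hη
    have h1 := ha η hη
    have h2 := hb η hη
    simp only [Pi.add_apply, mul_add, Finset.sum_add_distrib]
    rw [h1, h2, add_zero]
  zero_mem' := by intro η hη; simp
  smul_mem' := by
    intro c a ha η hη
    have h := ha η hη
    simp only [Pi.smul_apply, smul_eq_mul]
    calc ∑ j, star (η j) * (c * a j) = c * ∑ j, star (η j) * a j := by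
          rw [Finset.mul_sum]; exact Finset.sum_congr rfl fun j _ => by ring
      _ = 0 := by rw [h, mul_zero]

/-- Orthogonal complement of a set of matrices w.r.t. the Hilbert–Schmidt inner product. -/
def hsPerp {m n : ℕ} (S : Set (Matrix (Fin m) (Fin n) ℂ)) :
    Submodule ℂ (Matrix (Fin m) (Fin n) ℂ) where
  carrier := {W | ∀ V ∈ S, ∑ i, ∑ j, star (V i j) * W i j = 0}
  add_mem' := by
    intro a b ha hb V hV
    have h1 := ha V hV
    have h2 := hb V hV
    simp only [Matrix.add_apply, mul_add, Finset.sum_add_distrib]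
    rw [h1, h2, add_zero]
  zero_mem' := by intro V hV; simp
  smul_mem' := by
    intro c a ha V hV
    have h := ha V hV
    simp only [Matrix.smul_apply, smul_eq_mul]
    calc ∑ i, ∑ j, star (V i j) * (c * a i j)
        = c * ∑ i, ∑ j, star (V i j) * a i j := by
          rw [Finset.mul_sum]
          exact Finset.sum_congr rfl fun i _ => by
            rw [Finset.mul_sum]; exact Finset.sum_congr rfl fun j _ => by ring
      _ = 0 := by rw [h, mul_zero]

/-- `p` is the orthogonal projection matrix onto the subspace `B` of `ℂⁿ`. -/
def IsOrthProjOnto {n : ℕ} (p : Matrix (Fin n) (Fin n) ℂ) (B : Submodule ℂ (Fin n → ℂ)) : Prop :=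
  p.IsHermitian ∧ p * p = p ∧ (∀ η ∈ B, p.mulVec η = η) ∧ (∀ η, p.mulVec η ∈ B)

/-- A matrix of rank at most one is an outer product. -/
theorem exists_eq_vecMulVec_of_rank_le_one {K : Type*} [Field K] {m n : ℕ}
    (M : Matrix (Fin m) (Fin n) K) (hM : M.rank ≤ 1) :
    ∃ (ξ : Fin m → K) (g : Fin n → K), M = vecMulVec ξ g := by
  rw [Matrix.rank, finrank_le_one_iff] at hM
  obtain ⟨ξ, hξ⟩ := hM
  choose g hg using fun j : Fin n => hξ ⟨M.mulVecLin (Pi.single j 1), LinearMap.mem_range_self _ _⟩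
  refine ⟨ξ, g, ?_⟩
  ext i j
  have h := congrFun (congrArg Subtype.val (hg j)) i
  simp only [Submodule.coe_smul, Pi.smul_apply, smul_eq_mul, Matrix.mulVecLin_apply,
    Matrix.mulVec_single_one, Matrix.col_apply] at h
  rw [vecMulVec_apply, ← h, mul_comm]

theorem rank_vecMulVec_le_one {K : Type*} [Field K] {m n : ℕ} (ξ : Fin m → K) (g : Fin n → K) :
    (vecMulVec ξ g).rank ≤ 1 := by
  rw [Matrix.vecMulVec_eq (Fin 1)]
  exact (Matrix.rank_mul_le_right _ _).trans ((Matrix.rank_le_card_height _).trans (by simp))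

/-- Row vectors coming from `B` are fixed by right multiplication with the projection onto `B`. -/
theorem IsOrthProjOnto.star_vecMul {n : ℕ} {p : Matrix (Fin n) (Fin n) ℂ}
    {B : Submodule ℂ (Fin n → ℂ)} (hp : IsOrthProjOnto p B) {η : Fin n → ℂ} (hη : η ∈ B) :
    star η ᵥ* p = star η := by
  conv_rhs => rw [← hp.2.2.1 η hη, star_mulVec, hp.1.eq]

theorem IsOrthProjOnto.star_vecMul_mem {n : ℕ} {p : Matrix (Fin n) (Fin n) ℂ}
    {B : Submodule ℂ (Fin n → ℂ)} (hp : IsOrthProjOnto p B) (v : Fin n → ℂ) :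
    star (v ᵥ* p) ∈ B := by
  rw [Matrix.star_vecMul, hp.1.eq]
  exact hp.2.2.2 _

/-- A matrix orthogonal to all `α η*` with `η ∈ B` is, after compression to `B`, annihilated
by `α*`. -/
theorem star_vecMul_mul_eq_zero {m n : ℕ} {p : Matrix (Fin n) (Fin n) ℂ}
    {B : Submodule ℂ (Fin n → ℂ)} (hp : IsOrthProjOnto p B) (α : Fin m → ℂ)
    {a : Matrix (Fin m) (Fin n) ℂ}
    (ha : a ∈ hsPerp {M : Matrix (Fin m) (Fin n) ℂ | ∃ η ∈ B, M = vecMulVec α (star η)}) :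
    star α ᵥ* (a * p) = 0 := by
  ext j
  have hη : p.col j ∈ B := by
    rw [← Matrix.mulVec_single_one]
    exact hp.2.2.2 _
  have h := ha _ ⟨_, hη, rfl⟩
  rw [Pi.zero_apply, ← h]
  simp only [Matrix.vecMul, dotProduct, Matrix.mul_apply, Finset.mul_sum, vecMulVec_apply,
    Pi.star_apply, star_mul', star_star, Matrix.col_apply]
  exact Finset.sum_congr rfl fun i _ => Finset.sum_congr rfl fun k _ => by ring

/-- Every rank-at-most-one matrix of the form `a(1-p)` with `a ∈ D₂` equals `α γ*` for some
`γ ∈ B^⊥`. -/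
theorem stmt3 (n : ℕ) (D : Submodule ℂ (Matrix (Fin 2) (Fin n) ℂ))
    (α : Fin 2 → ℂ) (hα : α ≠ 0) (B : Submodule ℂ (Fin n → ℂ))
    (hD1 : {V | V ∈ D ∧ V.rank ≤ 1} =
      {M : Matrix (Fin 2) (Fin n) ℂ | ∃ η ∈ B, M = vecMulVec α (star η)})
    (p : Matrix (Fin n) (Fin n) ℂ) (hp : IsOrthProjOnto p B)
    (a : Matrix (Fin 2) (Fin n) ℂ)
    (ha : a ∈ D ⊓ hsPerp {V | V ∈ D ∧ V.rank ≤ 1})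
    (hrk : (a * (1 - p)).rank ≤ 1) :
    ∃ γ ∈ vPerp B, a * (1 - p) = vecMulVec α (star γ) := by
  obtain ⟨haD, haP⟩ := ha
  rw [hD1] at haP
  have hp1 : (1 - p) * p = 0 := by rw [sub_mul, one_mul, hp.2.1, sub_self]
  set s : ℂ := star (α 0) * α 0 + star (α 1) * α 1 with hs
  have hs0 : s ≠ 0 := by
    have h := (dotProduct_star_self_eq_zero (v := α)).not.mpr hα
    rwa [dotProduct, Fin.sum_univ_two, Pi.star_apply, Pi.star_apply] at h
  obtain ⟨ξ, g, hc⟩ := exists_eq_vecMulVec_of_rank_le_one _ hrk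
  have hα_N := star_vecMul_mul_eq_zero hp α haP
  set w : ℂ := α 0 * ξ 1 - α 1 * ξ 0 with hw
  set τ : ℂ := star (α 0) * ξ 0 + star (α 1) * ξ 1 with hτ
  set r : Fin n → ℂ := ![-α 1, α 0] ᵥ* (a * p) with hr
  have hrB : star r ∈ B := by
    rw [hr, ← vecMul_vecMul]
    exact hp.star_vecMul_mem _
  have hcomb : (s * w) • a + vecMulVec α (τ • r) = vecMulVec ξ (s • r + (s * w) • g) := by
    have ha_split : a = a * p + vecMulVec ξ g := by
      rw [← hc, Matrix.mul_sub, Matrix.mul_one, add_sub_cancel]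
    ext i j
    have h0 := congrFun hα_N j
    have h1 := congrFun hr j
    have h2 := congrFun (congrFun ha_split i) j
    simp only [Matrix.vecMul, dotProduct, Fin.sum_univ_two, Pi.star_apply, Pi.zero_apply,
      Matrix.cons_val_zero, Matrix.cons_val_one, Matrix.add_apply, vecMulVec_apply] at h0 h1 h2
    simp only [Matrix.add_apply, Matrix.smul_apply, vecMulVec_apply, smul_eq_mul, Pi.add_apply,
      Pi.smul_apply]
    rw [h2, h1, hs, hw, hτ]
    fin_cases i
    · simp only [Fin.zero_eta, Fin.isValue]
      linear_combination (α 0 * ξ 1 - α 1 * ξ 0) * α 0 * h0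
    · simp only [Fin.mk_one, Fin.isValue]
      linear_combination (α 0 * ξ 1 - α 1 * ξ 0) * α 1 * h0
  have hαr : vecMulVec α (τ • r) ∈ D := by
    have h : vecMulVec α (τ • r) ∈ {V | V ∈ D ∧ V.rank ≤ 1} := by
      rw [hD1]
      exact ⟨star (τ • r), by rw [star_smul]; exact B.smul_mem _ hrB, by rw [star_star]⟩
    exact h.1
  have hmem : (s * w) • a + vecMulVec α (τ • r) ∈ {V | V ∈ D ∧ V.rank ≤ 1} :=
    ⟨D.add_mem (D.smul_mem _ haD) hαr, hcomb ▸ rank_vecMulVec_le_one _ _⟩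
  rw [hD1] at hmem
  obtain ⟨η, hη, hη_eq⟩ := hmem
  have hrow : ∀ v : Fin n → ℂ, star v ∈ B → vecMulVec α v * (1 - p) = 0 := by
    intro v hv
    have h := hp.star_vecMul hv
    rw [star_star] at h
    rw [vecMulVec_mul, vecMul_sub, vecMul_one, h, sub_self]
    ext; simp [vecMulVec_apply]
  have hzero : (s * w) • (a * (1 - p)) = 0 := by
    have h := congrArg (· * (1 - p)) hη_eq
    simp only [Matrix.add_mul, Matrix.smul_mul] at h
    rwa [hrow _ (by rw [star_smul]; exact B.smul_mem _ hrB), hrow _ (by rwa [star_star]),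
      add_zero] at h
  obtain ⟨v, hv⟩ : ∃ v : Fin n → ℂ, a * (1 - p) = vecMulVec α v := by
    rcases smul_eq_zero.mp hzero with h | h
    · have hw0 : w = 0 := (mul_eq_zero.mp h).resolve_left hs0
      have hξ : ξ = (τ / s) • α := by
        ext i
        rw [Pi.smul_apply, smul_eq_mul, div_mul_eq_mul_div, eq_div_iff hs0, hs, hτ]
        rw [hw] at hw0
        fin_cases i
        · simp only [Fin.zero_eta, Fin.isValue]
          linear_combination -star (α 1) * hw0
        · simp only [Fin.mk_one, Fin.isValue]
          linear_combination star (α 0) * hw0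
      exact ⟨(τ / s) • g, by rw [hc, hξ, smul_vecMulVec, vecMulVec_smul]⟩
    · exact ⟨0, by rw [h]; ext; simp [vecMulVec_apply]⟩
  refine ⟨star v, fun η hη => ?_, by rw [star_star, hv]⟩
  obtain ⟨i, hi⟩ := Function.ne_iff.mp hα
  have h : (a * (1 - p)) *ᵥ η = 0 := by
    rw [← hp.2.2.1 η hη, mulVec_mulVec, Matrix.mul_assoc, hp1, Matrix.mul_zero, zero_mulVec]
  rw [hv] at h
  have hi' := congrFun h i
  simp only [mulVec, dotProduct, vecMulVec_apply, mul_assoc, ← Finset.mul_sum, Pi.zero_apply]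
    at hi'
  have hsum := congrArg star ((mul_eq_zero.mp hi').resolve_left hi)
  simpa only [star_sum, star_mul', star_zero, mul_comm, Pi.star_apply] using hsum

end
end

section
/- Let D be a completely entangled ℂ-linear subspace of M_{2×n}(ℂ). Then there exist a finite family of vectors ξ_1, …, ξ_N ∈ ℂ² and η_1, …, η_N ∈ ℂⁿ such that D^⊥ = span{ξ_ι η_ι* : 1 ≤ ι ≤ N} and span{ξ̄_ι η_ι* : 1 ≤ ι ≤ N} = M_{2×n}(ℂ), where ξ̄ denotes the entrywise complex conjugate of ξ. -/
open Matrix Kronecker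
open scoped ComplexOrder

noncomputable section


/-- A linear pencil `P + sQ` that is injective for every finite `s` and at infinity has the following
rigidity: if it solves a pencil equation with right-hand side `b₁ + s b₂` for infinitely many `s`,
then it solves it with a solution independent of `s`. -/
theorem exists_const_of_pencil {K E F : Type*} [Field K] [IsAlgClosed K]
    [AddCommGroup E] [Module K E] [FiniteDimensional K E] [AddCommGroup F] [Module K F]
    (P Q : E →ₗ[K] F) (hP : ∀ s : K, Function.Injective (P + s • Q))
    (hQ : Function.Injective Q) {S : Set K} (hS : S.Infinite) (b₁ b₂ : F)
    (hb : ∀ s ∈ S, ∃ x, P x + s • Q x = b₁ + s • b₂) :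
    ∃ x, P x = b₁ ∧ Q x = b₂ := by
  classical
  choose! a ha using hb
  set X : Submodule K E := Submodule.span K ((fun p : K × K => a p.1 - a p.2) '' (S ×ˢ S)) with hX
  have hmem : ∀ s ∈ S, ∀ t ∈ S, a s - a t ∈ X := fun s hs t ht =>
    Submodule.subset_span ⟨(s, t), ⟨hs, ht⟩, rfl⟩
  obtain ⟨T, hTS, hT⟩ :=
    (Submodule.fg_span_iff_fg_span_finset_subset _).1 (IsNoetherian.noetherian X)
  obtain ⟨U, hUS, rfl⟩ := Finset.subset_set_image_iff.1 hTS
  obtain ⟨t, htS, htU⟩ := hS.exists_notMem_finset (U.image Prod.fst ∪ U.image Prod.snd)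
  have hquot : ∀ s ∈ S, s ≠ t → Q (a s) - b₂ ∈ X.map (P + t • Q) := by
    intro s hs hst
    have h0 : t - s ≠ 0 := sub_ne_zero.2 (Ne.symm hst)
    refine ⟨(t - s)⁻¹ • (a s - a t), X.smul_mem _ (hmem s hs t htS), ?_⟩
    have key : (P + t • Q) (a s - a t) = (t - s) • (Q (a s) - b₂) := by
      have h1 := ha s hs
      have h2 := ha t htS
      have h3 : P (a s) = b₁ + s • b₂ - s • Q (a s) := by rw [← h1]; abel
      have h4 : P (a t) = b₁ + t • b₂ - t • Q (a t) := by rw [← h2]; abel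
      simp only [LinearMap.add_apply, LinearMap.smul_apply, map_sub, h3, h4]
      module
    rw [map_smul, key, inv_smul_smul₀ h0]
  have hle : X.map Q ≤ X.map (P + t • Q) := by
    conv_lhs => rw [hX, hT]
    rw [Submodule.map_span, Submodule.span_le]
    rintro _ ⟨_, hz, rfl⟩
    obtain ⟨⟨s, s'⟩, hp, rfl⟩ := Finset.mem_image.1 (Finset.mem_coe.1 hz)
    have hsS := hUS hp
    simp only [Finset.mem_union, Finset.mem_image, not_or] at htU
    have h1 := hquot s hsS.1 fun h => htU.1 ⟨_, hp, h⟩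
    have h2 := hquot s' hsS.2 fun h => htU.2 ⟨_, hp, h⟩
    have := Submodule.sub_mem _ h1 h2
    simpa using this
  have heq : X.map Q = X.map (P + t • Q) := by
    apply Submodule.eq_of_le_of_finrank_eq hle
    rw [← (Submodule.equivMapOfInjective Q hQ X).finrank_eq,
      ← (Submodule.equivMapOfInjective _ (hP t) X).finrank_eq]
  have hPX : ∀ x ∈ X, P x ∈ X.map Q := by
    intro x hx
    have h1 : (P + t • Q) x ∈ X.map Q := heq ▸ Submodule.mem_map_of_mem hx
    have h2 := Submodule.sub_mem _ h1
      ((X.map Q).smul_mem t (Submodule.mem_map_of_mem (f := Q) hx))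
    simpa using h2
  have hbot : X = ⊥ := by
    by_contra hne
    have : Nontrivial X := Submodule.nontrivial_iff_ne_bot.2 hne
    obtain ⟨μ, hμ⟩ := Module.End.exists_eigenvalue
      ((Submodule.equivMapOfInjective Q hQ X).symm.toLinearMap ∘ₗ P.restrict hPX)
    obtain ⟨v, hv, hv0⟩ := hμ.exists_hasEigenvector
    rw [Module.End.mem_eigenspace_iff] at hv
    have h1 := congrArg (fun z : X => Q z) hv
    simp only [LinearMap.comp_apply, LinearEquiv.coe_coe,
      Submodule.map_equivMapOfInjective_symm_apply] at h1
    have h2 : (P + (-μ) • Q) v = (P + (-μ) • Q) 0 := by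
      have h3 : P v = μ • Q v := by simpa using h1
      simp [h3]
    exact hv0 (Subtype.ext (hP _ h2))
  obtain ⟨s, hs, t, ht, hst⟩ := hS.nontrivial
  have hast : a s = a t := by
    have := hmem s hs t ht
    rw [hbot, Submodule.mem_bot] at this
    exact sub_eq_zero.1 this
  have h1 := ha s hs
  have h2 := ha t ht
  rw [← hast] at h2
  have hQb : Q (a s) = b₂ := by
    have h3 : (s - t) • Q (a s) = (s - t) • b₂ := by
      have := congrArg₂ (· - ·) h1 h2
      simpa [sub_smul] using this
    exact smul_right_injective F (sub_ne_zero.2 hst) h3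
  refine ⟨a s, ?_, hQb⟩
  rw [hQb] at h1
  exact add_right_cancel h1

theorem Matrix.eq_zero_of_rank_vecMulVec_ne_one {K : Type*} [Field K] {m n : ℕ}
    {u : Fin m → K} {w : Fin n → K} (h : (vecMulVec u w).rank ≠ 1) : vecMulVec u w = 0 := by
  have h0 : (vecMulVec u w).rank = 0 := by
    have := rank_vecMulVec_le u w
    omega
  rw [Matrix.rank, Submodule.finrank_eq_zero, LinearMap.range_eq_bot] at h0
  exact Matrix.toLin'.injective (h0.trans (map_zero _).symm)

/-- The entrywise complex conjugate of a subspace of matrices. -/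
def conjSubmodule {m n : ℕ} (D : Submodule ℂ (Matrix (Fin m) (Fin n) ℂ)) :
    Submodule ℂ (Matrix (Fin m) (Fin n) ℂ) where
  carrier := {A | A.map star ∈ D}
  add_mem' := by
    intro a b ha hb
    have : (a + b).map star = a.map star + b.map star := by ext; simp
    simpa only [Set.mem_ofPred_eq, this] using D.add_mem ha hb
  zero_mem' := by
    have : (0 : Matrix (Fin m) (Fin n) ℂ).map star = 0 := by ext; simp
    simp only [Set.mem_ofPred_eq, this, D.zero_mem]
  smul_mem' := by
    intro c a ha
    have : (c • a).map star = star c • a.map star := by ext; simp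
    simpa only [Set.mem_ofPred_eq, this] using D.smul_mem _ ha

theorem eq_zero_of_mem_conjSubmodule {n : ℕ} {D : Submodule ℂ (Matrix (Fin 2) (Fin n) ℂ)}
    (hD : ∀ V ∈ D, V.rank ≠ 1) {u : Fin 2 → ℂ} {w : Fin n → ℂ}
    (h : vecMulVec u w ∈ conjSubmodule D) : vecMulVec u w = 0 := by
  have h1 : (vecMulVec u w).map star = vecMulVec (star u) (star w) := by
    ext; simp [vecMulVec_apply]
  have h2 : (vecMulVec u w).map star ∈ D := h
  have h3 := hD _ h2
  rw [h1] at h3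
  have h4 := h1.trans (Matrix.eq_zero_of_rank_vecMulVec_ne_one h3)
  ext i j
  simpa using congrFun (congrFun h4 i) j

/-- If `b₁ + s b₂` annihilates, for infinitely many `s`, every `ζ` with `(1, s) ⊗ ζ ⟂ D`, then
the matrix with rows `b₁, b₂` lies in the conjugate of `D`. -/
theorem mem_conjSubmodule_of_annihilates {n : ℕ} {D : Submodule ℂ (Matrix (Fin 2) (Fin n) ℂ)}
    (hD : ∀ V ∈ D, V.rank ≠ 1) {S : Set ℂ} (hS : S.Infinite) (b₁ b₂ : Fin n → ℂ)
    (hb : ∀ s ∈ S, ∀ ζ : Fin n → ℂ, vecMulVec ![1, s] ζ ∈ hsPerp (D : Set _) →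
      (b₁ + s • b₂) ⬝ᵥ ζ = 0) :
    Matrix.of ![b₁, b₂] ∈ conjSubmodule D := by
  let P : conjSubmodule D →ₗ[ℂ] (Fin n → ℂ) :=
    { toFun := fun A => A.1 0, map_add' := fun _ _ => rfl, map_smul' := fun _ _ => rfl }
  let Q : conjSubmodule D →ₗ[ℂ] (Fin n → ℂ) :=
    { toFun := fun A => A.1 1, map_add' := fun _ _ => rfl, map_smul' := fun _ _ => rfl }
  have hP : ∀ s : ℂ, Function.Injective (P + s • Q) := by
    intro s
    rw [injective_iff_map_eq_zero]
    rintro ⟨A, hA⟩ h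
    have h0 : A 0 = -s • A 1 := by
      have : A 0 + s • A 1 = 0 := h
      rw [neg_smul]
      exact eq_neg_of_add_eq_zero_left this
    have hA' : A = vecMulVec ![-s, 1] (A 1) := by
      ext i j
      fin_cases i
      · simp [vecMulVec_apply, h0]
      · simp [vecMulVec_apply]
    rw [hA'] at hA
    exact Subtype.ext (hA'.trans (eq_zero_of_mem_conjSubmodule hD hA))
  have hQ : Function.Injective Q := by
    rw [injective_iff_map_eq_zero]
    rintro ⟨A, hA⟩ h
    have h0 : A 1 = 0 := h
    have hA' : A = vecMulVec ![1, 0] (A 0) := by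
      ext i j
      fin_cases i
      · simp [vecMulVec_apply]
      · simp [vecMulVec_apply, h0]
    rw [hA'] at hA
    exact Subtype.ext (hA'.trans (eq_zero_of_mem_conjSubmodule hD hA))
  obtain ⟨⟨A, hA⟩, h1, h2⟩ := exists_const_of_pencil P Q hP hQ hS b₁ b₂ fun s hs => by
    change b₁ + s • b₂ ∈ LinearMap.range (P + s • Q)
    by_contra hnot
    obtain ⟨f, hf, hle⟩ := Submodule.exists_le_ker_of_notMem hnot
    have hfd : ∀ v, f v = v ⬝ᵥ fun j => f (Pi.single j 1) := by
      intro v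
      conv_lhs => rw [← Finset.univ_sum_single v]
      rw [map_sum, dotProduct]
      refine Finset.sum_congr rfl fun j _ => ?_
      rw [← mul_one (v j), ← smul_eq_mul, Pi.single_smul, map_smul]
      simp
    apply hf
    rw [hfd]
    apply hb s hs
    intro V hV
    have hV' : V.map star ∈ conjSubmodule D := by
      change (V.map star).map star ∈ D
      have : (V.map star).map star = V := by ext; simp
      rwa [this]
    have h3 : f ((P + s • Q) ⟨_, hV'⟩) = 0 := hle ⟨_, rfl⟩
    rw [hfd] at h3
    rw [← h3, Fin.sum_univ_two, ← Finset.sum_add_distrib]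
    refine Finset.sum_congr rfl fun j _ => ?_
    have hj : (P + s • Q) ⟨_, hV'⟩ j = star (V 0 j) + s * star (V 1 j) := rfl
    rw [hj]
    simp [vecMulVec_apply]
    ring
  have : Matrix.of ![b₁, b₂] = A := by
    ext i j
    fin_cases i
    · exact congrFun h1.symm j
    · exact congrFun h2.symm j
  rwa [this]

theorem Matrix.dual_apply_eq_sum {K : Type*} [Field K] {m n : ℕ}
    (φ : Matrix (Fin m) (Fin n) K →ₗ[K] K) (W : Matrix (Fin m) (Fin n) K) :
    φ W = ∑ i, ∑ j, φ (Matrix.single i j 1) * W i j := by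
  conv_lhs => rw [Matrix.matrix_eq_sum_single W]
  simp only [map_sum]
  refine Finset.sum_congr rfl fun i _ => Finset.sum_congr rfl fun j _ => ?_
  rw [← mul_one (W i j), ← smul_eq_mul, ← Matrix.smul_single, map_smul]
  simp [mul_comm]

theorem Matrix.dual_vecMulVec {K : Type*} [Field K] {n : ℕ}
    (φ : Matrix (Fin 2) (Fin n) K →ₗ[K] K) (s : K) (ζ : Fin n → K) :
    φ (vecMulVec ![1, s] ζ) = ((fun j => φ (Matrix.single 0 j 1)) +
      s • fun j => φ (Matrix.single 1 j 1)) ⬝ᵥ ζ := by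
  rw [Matrix.dual_apply_eq_sum, Fin.sum_univ_two, ← Finset.sum_add_distrib]
  refine Finset.sum_congr rfl fun j _ => ?_
  simp [vecMulVec_apply]
  ring

theorem hsPerp_le_span_vecMulVec {n : ℕ} (D : Submodule ℂ (Matrix (Fin 2) (Fin n) ℂ))
    (hD : ∀ V ∈ D, V.rank ≠ 1) :
    hsPerp (D : Set (Matrix (Fin 2) (Fin n) ℂ)) ≤
      Submodule.span ℂ ((fun p : (Fin 2 → ℂ) × (Fin n → ℂ) => vecMulVec p.1 (star p.2)) ''
        {p | vecMulVec p.1 (star p.2) ∈ hsPerp (D : Set _)}) := by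
  intro W hW
  by_contra hnot
  obtain ⟨φ, hφ, hle⟩ := Submodule.exists_le_ker_of_notMem hnot
  apply hφ
  have hmem := mem_conjSubmodule_of_annihilates hD (Set.infinite_univ (α := ℂ))
    (fun j => φ (Matrix.single 0 j 1)) (fun j => φ (Matrix.single 1 j 1)) fun s _ ζ hζ => by
      rw [← Matrix.dual_vecMulVec]
      exact hle (Submodule.subset_span ⟨(![1, s], star ζ), by simpa using hζ, by simp only [star_star]⟩)
  rw [Matrix.dual_apply_eq_sum, ← hW _ hmem]
  simp [Fin.sum_univ_two]

theorem span_vecMulVec_star_eq_top {n : ℕ} (D : Submodule ℂ (Matrix (Fin 2) (Fin n) ℂ))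
    (hD : ∀ V ∈ D, V.rank ≠ 1) :
    Submodule.span ℂ ((fun p : (Fin 2 → ℂ) × (Fin n → ℂ) => vecMulVec (star p.1) (star p.2)) ''
        {p | vecMulVec p.1 (star p.2) ∈ hsPerp (D : Set _)}) = ⊤ := by
  rw [eq_top_iff]
  intro W _
  by_contra hnot
  obtain ⟨φ, hφ, hle⟩ := Submodule.exists_le_ker_of_notMem hnot
  apply hφ
  set b₁ : Fin n → ℂ := fun j => φ (Matrix.single 0 j 1) with hb₁
  set b₂ : Fin n → ℂ := fun j => φ (Matrix.single 1 j 1) with hb₂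
  have hker : ∀ s : ℂ, ∀ ζ : Fin n → ℂ, vecMulVec ![1, s] ζ ∈ hsPerp (D : Set _) →
      (b₁ + star s • b₂) ⬝ᵥ ζ = 0 := by
    intro s ζ hζ
    rw [← Matrix.dual_vecMulVec]
    refine hle (Submodule.subset_span ⟨(![1, s], star ζ), by simpa using hζ, ?_⟩)
    have : star ![1, s] = ![1, star s] := by ext i; fin_cases i <;> simp
    simp only [this, star_star]
  -- On each horizontal line the conjugation `s ↦ star s` is a translation.
  have hline : ∀ c : ℂ, star c = -c → Matrix.of ![b₁ - (2 * c) • b₂, b₂] ∈ conjSubmodule D := by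
    intro c hc
    have hinf : (Set.range fun x : ℝ => (x : ℂ) + c).Infinite :=
      Set.infinite_range_of_injective fun x y h => by simpa using h
    refine mem_conjSubmodule_of_annihilates hD hinf _ _ ?_
    rintro _ ⟨x, rfl⟩ ζ hζ
    have h := hker _ ζ hζ
    have h1 : star ((x : ℂ) + c) = x - c := by
      rw [star_add, hc]; simp [sub_eq_add_neg]
    rw [h1] at h
    rw [← h]
    congr 1
    module
  have h0 := hline 0 (by simp)
  have hI := hline Complex.I (by simp)
  have hb2 : b₂ = 0 := by
    have h : vecMulVec ![2 * Complex.I, 0] b₂ ∈ conjSubmodule D := by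
      convert (conjSubmodule D).sub_mem h0 hI using 1
      ext i j
      fin_cases i <;> simp [vecMulVec_apply]
    have h' := eq_zero_of_mem_conjSubmodule hD h
    ext j
    simpa [vecMulVec_apply] using congrFun (congrFun h' 0) j
  have hb1 : b₁ = 0 := by
    have h : vecMulVec ![1, 0] b₁ ∈ conjSubmodule D := by
      convert h0 using 1
      ext i j
      fin_cases i <;> simp [vecMulVec_apply, hb2]
    have h' := eq_zero_of_mem_conjSubmodule hD h
    ext j
    simpa [vecMulVec_apply] using congrFun (congrFun h' 0) j
  rw [Matrix.dual_apply_eq_sum, Fin.sum_univ_two]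
  simp [fun j => congrFun (hb₁.symm.trans hb1) j, fun j => congrFun (hb₂.symm.trans hb2) j]

/-- Finitely many indices suffice to span, simultaneously, the images of two families of vectors
in finite-dimensional spaces. -/
theorem exists_fin_span_image_eq {K α E F : Type*} [Field K]
    [AddCommGroup E] [Module K E] [FiniteDimensional K E]
    [AddCommGroup F] [Module K F] [FiniteDimensional K F] (f : α → E) (g : α → F) (s : Set α) :
    ∃ (N : ℕ) (p : Fin N → α), (∀ i, p i ∈ s) ∧
      Submodule.span K (Set.range fun i => f (p i)) = Submodule.span K (f '' s) ∧
      Submodule.span K (Set.range fun i => g (p i)) = Submodule.span K (g '' s) := by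
  obtain ⟨u, hu, hspan, -⟩ :=
    Submodule.exists_fun_fin_finrank_span_eq K ((fun a => (f a, g a)) '' s)
  choose p hps hp using hu
  obtain rfl : (fun i => (f (p i), g (p i))) = u := funext hp
  refine ⟨_, p, hps, ?_, ?_⟩
  · have h := congrArg (Submodule.map (LinearMap.fst K E F)) hspan
    simpa only [Submodule.map_span, ← Set.range_comp, Set.image_image, Function.comp_def,
      LinearMap.fst_apply] using h
  · have h := congrArg (Submodule.map (LinearMap.snd K E F)) hspan
    simpa only [Submodule.map_span, ← Set.range_comp, Set.image_image, Function.comp_def,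
      LinearMap.snd_apply] using h

/-- If `D ⊆ M_{2×n}(ℂ)` is completely entangled, then `(D^⊥, {0}^⊥)` satisfies the range
criterion. -/
theorem stmt8 (n : ℕ) (D : Submodule ℂ (Matrix (Fin 2) (Fin n) ℂ))
    (hD : ∀ V ∈ D, V.rank ≠ 1) :
    ∃ (N : ℕ) (ξ : Fin N → Fin 2 → ℂ) (η : Fin N → Fin n → ℂ),
      hsPerp (D : Set (Matrix (Fin 2) (Fin n) ℂ)) =
        Submodule.span ℂ (Set.range fun ι => vecMulVec (ξ ι) (star (η ι))) ∧
      Submodule.span ℂ (Set.range fun ι => vecMulVec (star (ξ ι)) (star (η ι))) = ⊤ := by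
  obtain ⟨N, p, hp, hf, hg⟩ := exists_fin_span_image_eq (K := ℂ)
    (fun p : (Fin 2 → ℂ) × (Fin n → ℂ) => vecMulVec p.1 (star p.2))
    (fun p : (Fin 2 → ℂ) × (Fin n → ℂ) => vecMulVec (star p.1) (star p.2))
    {p | vecMulVec p.1 (star p.2) ∈ hsPerp (D : Set _)}
  refine ⟨N, fun i => (p i).1, fun i => (p i).2, le_antisymm ?_ ?_, ?_⟩
  · exact (hsPerp_le_span_vecMulVec D hD).trans hf.ge
  · rw [Submodule.span_le]
    rintro _ ⟨i, rfl⟩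
    exact hp i
  · exact hg.trans (span_vecMulVec_star_eq_top D hD)

end
end

section
/- Let m, n ≥ 1 and V ∈ M_{m×n}(ℂ). There exists a finite family W_1, …, W_N ∈ M_{m×n}(ℂ) such that V* Xᵀ V = Σ_{i=1}^{N} W_i* X W_i for all X ∈ M_m(ℂ) if and only if rank V ≤ 1. (Equivalently: the completely copositive map φ^V(X) = V*XᵀV is completely positive if and only if V has rank at most 1.) -/
open Matrix Kronecker
open scoped ComplexOrder

noncomputable section

/-- A matrix of rank at most one is an outer product. -/
theorem exists_eq_vecMulVec_of_rank_le_one_s13 {m n K : Type*} [Finite m] [Fintype n]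
    [DecidableEq n] [Field K] {V : Matrix m n K} (h : V.rank ≤ 1) :
    ∃ (a : m → K) (b : n → K), V = vecMulVec a b := by
  obtain ⟨v, hv⟩ := finrank_le_one_iff.mp h
  choose c hc using fun q => hv ⟨V.mulVecLin (Pi.single q 1), LinearMap.mem_range_self _ _⟩
  refine ⟨v, c, ?_⟩
  ext p q
  have := congrFun (congrArg Subtype.val (hc q)) p
  simpa [vecMulVec_apply, mul_comm] using this.symm

/-- A matrix with vanishing `2 × 2` minors has rank at most one. -/
theorem rank_le_one_of_minors_eq_zero {m n K : Type*} [Fintype n] [Field K]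
    {V : Matrix m n K} (h : ∀ k l p q, V k p * V l q = V k q * V l p) : V.rank ≤ 1 := by
  by_cases h0 : V = 0
  · simp [h0]
  obtain ⟨k, p, hkp⟩ : ∃ k p, V k p ≠ 0 := by
    by_contra! hV
    exact h0 (Matrix.ext hV)
  have hV : V = vecMulVec (fun l => V l p) (fun q => V k q / V k p) := by
    ext l q
    rw [vecMulVec_apply, mul_div_assoc', eq_div_iff hkp]
    linear_combination h k l p q
  rw [hV]
  exact rank_vecMulVec_le _ _

/-- The completely copositive map of an outer product is completely positive. -/
theorem conjTranspose_vecMulVec_mul_transpose_mul {m n R : Type*} [Fintype m]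
    [CommRing R] [StarRing R] (a : m → R) (b : n → R) (X : Matrix m m R) :
    (vecMulVec a b)ᴴ * Xᵀ * vecMulVec a b =
      (vecMulVec (star a) b)ᴴ * X * vecMulVec (star a) b := by
  simp only [conjTranspose_vecMulVec, vecMulVec_mul, vecMul_vecMulVec, star_star,
    vecMul_transpose]
  rw [dotProduct_comm, dotProduct_mulVec]

theorem conjTranspose_mul_single_mul_apply {m n R : Type*} [Fintype m] [DecidableEq m]
    [Semiring R] [StarRing R] (W : Matrix m n R) (k l : m) (p q : n) :
    (Wᴴ * Matrix.single k l (1 : R) * W) p q = star (W k p) * W l q := by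
  simp [Matrix.mul_apply, single_apply, ite_and]

/-- If the completely copositive map of `V` is completely positive, then the `2 × 2` minors of
`V` vanish. -/
theorem minors_eq_zero_of_forall_eq_sum {m n ι : Type*} [Fintype m] [DecidableEq m] [Fintype ι]
    {V : Matrix m n ℂ} {W : ι → Matrix m n ℂ}
    (h : ∀ X : Matrix m m ℂ, Vᴴ * Xᵀ * V = ∑ i, (W i)ᴴ * X * W i) (k l : m) (p q : n) :
    V k p * V l q = V k q * V l p := by
  have entry (k l : m) (p q : n) :
      ∑ i, star (W i k p) * W i l q = star (V l p) * V k q := by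
    have := congrFun (congrFun (h (Matrix.single k l 1)) p) q
    rw [transpose_single, conjTranspose_mul_single_mul_apply, Matrix.sum_apply] at this
    simpa only [conjTranspose_mul_single_mul_apply] using this.symm
  let κ : Fin 4 → m := ![k, k, l, l]
  let π : Fin 4 → n := ![p, q, p, q]
  let z : Fin 4 → ℂ := ![-V k q, V k p, -V l q, V l p]
  have expand : ∑ i, star (∑ s, z s * W i (κ s) (π s)) * ∑ s, z s * W i (κ s) (π s) =
      ∑ s, ∑ t, star (z s) * z t * (star (V (κ t) (π s)) * V (κ s) (π t)) := by
    simp only [star_sum, Finset.sum_mul_sum, ← entry]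
    simp only [Finset.mul_sum]
    rw [Finset.sum_comm]
    refine Finset.sum_congr rfl fun s _ => ?_
    rw [Finset.sum_comm]
    refine Finset.sum_congr rfl fun t _ => Finset.sum_congr rfl fun i _ => ?_
    rw [star_mul']
    ring
  have value : ∑ s, ∑ t, star (z s) * z t * (star (V (κ t) (π s)) * V (κ s) (π t)) =
      -(2 * (star (V k p * V l q - V k q * V l p) * (V k p * V l q - V k q * V l p))) := by
    simp [Fin.sum_univ_four, κ, π, z]
    ring
  set d := V k p * V l q - V k q * V l p
  have nonneg : 0 ≤ -(2 * (star d * d)) := by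
    rw [← value, ← expand]
    exact Finset.sum_nonneg fun i _ => star_mul_self_nonneg _
  have sq : star d * d = 0 := by
    have := le_antisymm (neg_nonneg.mp nonneg) (mul_nonneg zero_le_two (star_mul_self_nonneg d))
    exact (mul_eq_zero.mp this).resolve_left two_ne_zero
  rcases mul_eq_zero.mp sq with h0 | h0
  · exact sub_eq_zero.mp (star_eq_zero.mp h0)
  · exact sub_eq_zero.mp h0

/-- The completely copositive map `φ^V : X ↦ V* Xᵀ V` is completely positive iff
`rank V ≤ 1`. -/
theorem stmt13 (m n : ℕ) (hm : 1 ≤ m) (hn : 1 ≤ n) (V : Matrix (Fin m) (Fin n) ℂ) :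
    (∃ (N : ℕ) (W : Fin N → Matrix (Fin m) (Fin n) ℂ),
        ∀ X : Matrix (Fin m) (Fin m) ℂ, Vᴴ * Xᵀ * V = ∑ i, (W i)ᴴ * X * (W i)) ↔
      V.rank ≤ 1 := by
  constructor
  · rintro ⟨N, W, h⟩
    exact rank_le_one_of_minors_eq_zero (minors_eq_zero_of_forall_eq_sum h)
  · intro h
    obtain ⟨a, b, rfl⟩ := exists_eq_vecMulVec_of_rank_le_one_s13 h
    refine ⟨1, fun _ => vecMulVec (star a) b, fun X => ?_⟩
    rw [Fin.sum_univ_one, conjTranspose_vecMulVec_mul_transpose_mul]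

end
end

section
/- Let n ≥ 2 and let D be a ℂ-linear subspace of M_{2×n}(ℂ) such that the set {V ∈ D : rank V ≤ 1} equals {ξβ* : ξ ∈ ℂ²} for a fixed nonzero vector β ∈ ℂⁿ. Then dim_ℂ D ≤ n, and the orthogonal complement D^⊥ in M_{2×n}(ℂ) equals the span of the matrices of rank at most 1 contained in D^⊥. -/
open Matrix Kronecker
open scoped ComplexOrder

noncomputable section


/-- If the pencil `A + z B` is injective at every `z ∈ ℂ ∪ {∞}`, then `(A + z B) x = p` is solvable
for all `z` only if `p = 0`. -/
theorem eq_zero_of_forall_pencil_solvable {E G : Type*} [AddCommGroup E] [Module ℂ E]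
    [FiniteDimensional ℂ E] [AddCommGroup G] [Module ℂ G] (A B : E →ₗ[ℂ] G)
    (hAB : ∀ (z : ℂ) (x : E), A x + z • B x = 0 → x = 0) (hB : Function.Injective B)
    (p : G) (hp : ∀ z : ℂ, ∃ x, A x + z • B x = p) : p = 0 := by
  choose y hy using hp
  have hdep : ¬ LinearIndependent ℂ y := fun h => not_finite_iff_infinite.2 inferInstance h.finite
  obtain ⟨z₀, hz₀⟩ : ∃ z₀, y z₀ ∈ Submodule.span ℂ (y '' {z₀}ᶜ) := by
    by_contra! h
    exact hdep (linearIndependent_iff_notMem_span.2 fun z => by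
      simpa [Set.compl_eq_univ_sdiff] using h z)
  set Y := Submodule.span ℂ (Set.range y)
  set T : E →ₗ[ℂ] G := A + z₀ • B
  have hyY : ∀ z, y z ∈ Y := fun z => Submodule.subset_span ⟨z, rfl⟩
  have hT : Function.Injective T :=
    (injective_iff_map_eq_zero T).2 fun x hx => hAB z₀ x (by simpa [T] using hx)
  have hT_ne : ∀ w ∈ ({z₀}ᶜ : Set ℂ), B (y w) ∈ Y.map T := by
    intro w hw
    have hne : w - z₀ ≠ 0 := sub_ne_zero.2 hw
    refine ⟨(w - z₀)⁻¹ • (y z₀ - y w), Y.smul_mem _ (Y.sub_mem (hyY _) (hyY _)), ?_⟩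
    have h : T (y z₀ - y w) = (w - z₀) • B (y w) := by
      rw [map_sub]
      simp only [T, LinearMap.add_apply, LinearMap.smul_apply]
      rw [hy z₀, ← hy w]
      module
    rw [map_smul, h, smul_smul, inv_mul_cancel₀ hne, one_smul]
  have hBT : Y.map B ≤ Y.map T := by
    rw [Submodule.map_le_iff_le_comap, Submodule.span_le]
    rintro _ ⟨w, rfl⟩
    by_cases hw : w = z₀
    · subst hw
      refine (Submodule.span_le (p := (Y.map T).comap B)).2 ?_ hz₀
      rintro _ ⟨v, hv, rfl⟩
      exact hT_ne v hv
    · exact hT_ne w hw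
  have hBT' : Y.map B = Y.map T :=
    Submodule.eq_of_le_of_finrank_eq hBT (by
      rw [← (Y.equivMapOfInjective B hB).finrank_eq, ← (Y.equivMapOfInjective T hT).finrank_eq])
  obtain ⟨L, hL⟩ := B.exists_leftInverse_of_injective (LinearMap.ker_eq_bot.2 hB)
  have hLB : ∀ u, L (B u) = u := fun u => LinearMap.congr_fun hL u
  have hTL : ∀ v ∈ Y, L (T v) ∈ Y ∧ B (L (T v)) = T v := by
    intro v hv
    obtain ⟨u, hu, huv⟩ : T v ∈ Y.map B := hBT' ▸ Submodule.mem_map_of_mem hv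
    rw [← huv, hLB]
    exact ⟨hu, rfl⟩
  have hYsub : Subsingleton Y := by
    by_contra hns
    have := not_subsingleton_iff_nontrivial.1 hns
    obtain ⟨μ, hμ⟩ := Module.End.exists_eigenvalue ((L ∘ₗ T).restrict fun v hv => (hTL v hv).1)
    obtain ⟨⟨v, hv⟩, hvec⟩ := hμ.exists_hasEigenvector
    have h1 : L (T v) = μ • v := congrArg Subtype.val hvec.apply_eq_smul
    have h2 : T v = μ • B v := by rw [← (hTL v hv).2, h1, map_smul]
    refine hvec.2 (Subtype.ext (hAB (z₀ - μ) v ?_))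
    have h3 : A v + z₀ • B v = μ • B v := h2
    rw [sub_smul, ← h3]
    abel
  have hy0 : y 0 = 0 := congrArg Subtype.val (Subsingleton.elim (⟨y 0, hyY 0⟩ : Y) 0)
  rw [← hy 0, hy0]
  simp

/-- The map `V ↦ ξᵀ V` on matrices. -/
def vecMulLeft {n : ℕ} (ξ : Fin 2 → ℂ) : Matrix (Fin 2) (Fin n) ℂ →ₗ[ℂ] (Fin n → ℂ) where
  toFun V := ξ ᵥ* V
  map_add' V W := Matrix.vecMul_add V W ξ
  map_smul' c V := by
    ext j
    simp [vecMul, dotProduct, Fin.sum_univ_two]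
    ring

theorem exists_eq_vecMulVec_of_vecMul_eq_zero {n : ℕ} {ξ : Fin 2 → ℂ} (hξ : ξ ≠ 0)
    {V : Matrix (Fin 2) (Fin n) ℂ} (hV : ξ ᵥ* V = 0) :
    ∃ γ : Fin n → ℂ, V = vecMulVec ![-ξ 1, ξ 0] γ := by
  have h : ∀ j, ξ 0 * V 0 j + ξ 1 * V 1 j = 0 := fun j => by
    simpa [vecMul, dotProduct, Fin.sum_univ_two] using congrFun hV j
  by_cases h0 : ξ 0 = 0
  · have h1 : ξ 1 ≠ 0 := fun h1 => hξ (by ext i; fin_cases i <;> simp [h0, h1])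
    refine ⟨fun j => -(V 0 j / ξ 1), ?_⟩
    ext i j
    have := h j
    fin_cases i
    · simp [vecMulVec_apply]; field_simp
    · simp_all [vecMulVec_apply]
  · refine ⟨fun j => V 1 j / ξ 0, ?_⟩
    ext i j
    have := h j
    fin_cases i
    · simp [vecMulVec_apply]; field_simp; linear_combination this
    · simp [vecMulVec_apply]; field_simp

section RankOnePart

variable {n : ℕ} {D : Submodule ℂ (Matrix (Fin 2) (Fin n) ℂ)} {β : Fin n → ℂ}

theorem exists_eq_smul_of_vecMul_eq_zero (hβ : β ≠ 0)
    (hD : ∀ V ∈ D, V.rank ≤ 1 → ∃ ξ : Fin 2 → ℂ, V = vecMulVec ξ (star β))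
    {ξ : Fin 2 → ℂ} (hξ : ξ ≠ 0) {V : Matrix (Fin 2) (Fin n) ℂ} (hVD : V ∈ D)
    (hV : ξ ᵥ* V = 0) : ∃ c : ℂ, V = c • vecMulVec ![-ξ 1, ξ 0] (star β) := by
  obtain ⟨γ, rfl⟩ := exists_eq_vecMulVec_of_vecMul_eq_zero hξ hV
  obtain ⟨η, hη⟩ := hD _ hVD (rank_vecMulVec_le _ _)
  obtain ⟨j, hj⟩ := Function.ne_iff.1 hβ
  have hj' : star (β j) ≠ 0 := star_ne_zero.2 hj
  have hη' : η = (γ j / star (β j)) • ![-ξ 1, ξ 0] := by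
    ext i
    have h := congrFun (congrFun hη i) j
    simp only [vecMulVec_apply, Pi.star_apply] at h
    simp only [Pi.smul_apply, smul_eq_mul]
    field_simp
    linear_combination -h
  exact ⟨γ j / star (β j), by rw [hη, hη', smul_vecMulVec]⟩

theorem mem_of_forall_vecMul_mem (hβ : β ≠ 0)
    (hD : ∀ V ∈ D, V.rank ≤ 1 → ∃ ξ : Fin 2 → ℂ, V = vecMulVec ξ (star β))
    (hβD : ∀ ξ : Fin 2 → ℂ, vecMulVec ξ (star β) ∈ D) {P : Matrix (Fin 2) (Fin n) ℂ}
    (hP : ∀ ξ : Fin 2 → ℂ, ∃ V ∈ D, ξ ᵥ* V = ξ ᵥ* P) : P ∈ D := by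
  have hββ : star β ⬝ᵥ β ≠ 0 := mt dotProduct_star_self_eq_zero.1 hβ
  have hsub : ∀ W : Matrix (Fin 2) (Fin n) ℂ,
      (W - vecMulVec ((star β ⬝ᵥ β)⁻¹ • (W *ᵥ β)) (star β)) *ᵥ β = 0 := by
    intro W
    rw [sub_mulVec, vecMulVec_mulVec]
    ext i
    simp
    field_simp
    simp
  set D₁ : Submodule ℂ (Matrix (Fin 2) (Fin n) ℂ) :=
    D ⊓ LinearMap.ker ((Matrix.mulVecBilin ℂ ℂ).flip β) with hD₁
  have memD₁ : ∀ V, V ∈ D₁ ↔ V ∈ D ∧ V *ᵥ β = 0 := fun V => by simp [hD₁]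
  have hinj : ∀ ξ : Fin 2 → ℂ, ξ ≠ 0 → ∀ V ∈ D₁, ξ ᵥ* V = 0 → V = 0 := by
    intro ξ hξ V hV hξV
    obtain ⟨hVD, hVβ⟩ := (memD₁ V).1 hV
    obtain ⟨c, rfl⟩ := exists_eq_smul_of_vecMul_eq_zero hβ hD hξ hVD hξV
    rw [← smul_vecMulVec, vecMulVec_mulVec] at hVβ
    have h0 : c • ![-ξ 1, ξ 0] = 0 := by
      ext i
      have := congrFun hVβ i
      simp only [Pi.smul_apply, MulOpposite.smul_eq_mul_unop, MulOpposite.unop_op,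
        Pi.zero_apply] at this
      exact (mul_eq_zero.1 this).resolve_right hββ
    rw [← smul_vecMulVec, h0, zero_vecMulVec]
  set P₁ := P - vecMulVec ((star β ⬝ᵥ β)⁻¹ • (P *ᵥ β)) (star β) with hP₁
  have hP₁D : ∀ ξ : Fin 2 → ℂ, ∃ V ∈ D₁, ξ ᵥ* V = ξ ᵥ* P₁ := by
    intro ξ
    obtain ⟨V, hV, hVP⟩ := hP ξ
    refine ⟨V - vecMulVec ((star β ⬝ᵥ β)⁻¹ • (V *ᵥ β)) (star β),
      (memD₁ _).2 ⟨D.sub_mem hV (hβD _), hsub V⟩, ?_⟩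
    rw [hP₁, vecMul_sub, vecMul_sub, vecMul_vecMulVec, vecMul_vecMulVec, dotProduct_smul,
      dotProduct_smul, dotProduct_mulVec, dotProduct_mulVec, hVP]
  suffices h : P₁ ∈ D₁ by
    have := D.add_mem ((memD₁ _).1 h).1 (hβD ((star β ⬝ᵥ β)⁻¹ • (P *ᵥ β)))
    rwa [hP₁, sub_add_cancel] at this
  obtain ⟨X, hX, hXP⟩ := hP₁D ![0, 1]
  have hpencil : ∀ (z : ℂ) (V : Matrix (Fin 2) (Fin n) ℂ),
      ![1, 0] ᵥ* V + z • (![0, 1] ᵥ* V) = ![1, z] ᵥ* V := by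
    intro z V
    rw [← smul_vecMul, ← add_vecMul]
    simp
  have hzero : (![1, 0] : Fin 2 → ℂ) ᵥ* (P₁ - X) = 0 := by
    refine eq_zero_of_forall_pencil_solvable ((vecMulLeft ![1, 0]).domRestrict D₁)
      ((vecMulLeft ![0, 1]).domRestrict D₁) ?_ ?_ _ ?_
    · rintro z ⟨V, hV⟩ h
      exact Subtype.ext (hinj ![1, z] (fun h => by simpa using congrFun h 0) V hV
        (by rw [← hpencil]; exact h))
    · refine (injective_iff_map_eq_zero _).2 ?_
      rintro ⟨V, hV⟩ h
      exact Subtype.ext (hinj ![0, 1] (fun h => by simpa using congrFun h 1) V hV h)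
    · intro z
      obtain ⟨V, hV, hVP⟩ := hP₁D ![1, z]
      refine ⟨⟨V - X, D₁.sub_mem hV hX⟩, ?_⟩
      change ![1, 0] ᵥ* (V - X) + z • (![0, 1] ᵥ* (V - X)) = _
      rw [hpencil, vecMul_sub, hVP, ← vecMul_sub, ← hpencil, vecMul_sub P₁ X ![0, 1],
        hXP, sub_self, smul_zero, add_zero]
  have hPX : P₁ = X := by
    rw [vecMul_sub, sub_eq_zero] at hzero
    ext i j
    fin_cases i
    · simpa [vecMul, dotProduct] using congrFun hzero j
    · simpa [vecMul, dotProduct] using (congrFun hXP j).symm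
  exact hPX ▸ hX

theorem finrank_le_of_rank_le_one (hn : 2 ≤ n) (hβ : β ≠ 0)
    (hD : ∀ V ∈ D, V.rank ≤ 1 → ∃ ξ : Fin 2 → ℂ, V = vecMulVec ξ (star β))
    (hβD : ∀ ξ : Fin 2 → ℂ, vecMulVec ξ (star β) ∈ D) : Module.finrank ℂ D ≤ n := by
  by_contra! hlt
  have htop : ∀ P, P ∈ D := by
    intro P
    refine mem_of_forall_vecMul_mem hβ hD hβD fun ξ => ?_
    by_cases hξ : ξ = 0
    · exact ⟨0, D.zero_mem, by simp [hξ]⟩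
    set f := (vecMulLeft (n := n) ξ).domRestrict D
    have hker : Module.finrank ℂ (LinearMap.ker f) ≤ 1 := by
      refine finrank_le_one ⟨⟨vecMulVec ![-ξ 1, ξ 0] (star β), hβD _⟩, ?_⟩ ?_
      · change ξ ᵥ* vecMulVec ![-ξ 1, ξ 0] (star β) = 0
        rw [vecMul_vecMulVec]
        simp [dotProduct, Fin.sum_univ_two]
        left
        ring
      · rintro ⟨⟨V, hV⟩, hVξ⟩
        obtain ⟨c, hc⟩ := exists_eq_smul_of_vecMul_eq_zero hβ hD hξ hV hVξ
        exact ⟨c, Subtype.ext (Subtype.ext hc.symm)⟩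
    have hrange : LinearMap.range f = ⊤ := by
      apply Submodule.eq_top_of_finrank_eq
      have h1 := f.finrank_range_add_finrank_ker
      have h2 := (LinearMap.range f).finrank_le
      rw [Module.finrank_fin_fun] at h2 ⊢
      omega
    obtain ⟨⟨V, hV⟩, h⟩ : ξ ᵥ* P ∈ LinearMap.range f := hrange ▸ Submodule.mem_top
    exact ⟨V, hV, h⟩
  obtain ⟨γ, hγ⟩ : ∃ γ, γ ∉ Submodule.span ℂ {star β} := by
    by_contra! h
    have h1 := finrank_span_singleton (K := ℂ) (star_ne_zero.2 hβ)
    rw [(Submodule.eq_top_iff'.2 h), finrank_top, Module.finrank_fin_fun] at h1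
    omega
  obtain ⟨ξ, hξ⟩ := hD (vecMulVec ![1, 0] γ) (htop _) (rank_vecMulVec_le _ _)
  refine hγ (Submodule.mem_span_singleton.2 ⟨ξ 0, ?_⟩)
  ext j
  simpa [vecMulVec_apply] using (congrFun (congrFun hξ 0) j).symm

theorem exists_vecMul_eq_of_orthogonal {P : Matrix (Fin 2) (Fin n) ℂ}
    (hP : ∀ (ξ : Fin 2 → ℂ) (γ : Fin n → ℂ),
      vecMulVec ξ γ ∈ hsPerp (D : Set (Matrix (Fin 2) (Fin n) ℂ)) →
        ∑ i, ∑ j, star (P i j) * vecMulVec ξ γ i j = 0)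
    (ξ : Fin 2 → ℂ) : ∃ V ∈ D, ξ ᵥ* V = ξ ᵥ* P := by
  by_contra hcon
  have hnot : ξ ᵥ* P ∉ D.map (vecMulLeft ξ) := fun ⟨V, hV, h⟩ => hcon ⟨V, hV, h⟩
  obtain ⟨f, hf, hker⟩ := Submodule.exists_le_ker_of_notMem hnot
  set g : Fin n → ℂ := fun j => f (Pi.single j 1) with hg
  have hform : ∀ V : Matrix (Fin 2) (Fin n) ℂ,
      ∑ i, ∑ j, star (V i j) * vecMulVec (star ξ) (star g) i j = star (f (ξ ᵥ* V)) := by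
    intro V
    rw [LinearMap.pi_apply_eq_sum_univ f, star_sum, Finset.sum_comm]
    refine Finset.sum_congr rfl fun j _ => ?_
    have : (fun k => if j = k then (1 : ℂ) else 0) = Pi.single j 1 := by
      ext k; simp [Pi.single_apply, eq_comm]
    rw [this]
    simp [vecMulVec_apply, vecMul, dotProduct, Fin.sum_univ_two, hg]
    ring
  refine hf (star_eq_zero.1 ?_)
  rw [← hform]
  refine hP _ _ fun V hV => ?_
  rw [hform, star_eq_zero]
  exact hker ⟨V, hV, rfl⟩

end RankOnePart

theorem exists_hilbertSchmidt_repr {m n : ℕ} (f : Matrix (Fin m) (Fin n) ℂ →ₗ[ℂ] ℂ) :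
    ∃ P : Matrix (Fin m) (Fin n) ℂ, ∀ W, f W = ∑ i, ∑ j, star (P i j) * W i j := by
  refine ⟨fun i j => star (f (Matrix.single i j 1)), fun W => ?_⟩
  conv_lhs => rw [matrix_eq_sum_single W]
  simp only [map_sum, star_star]
  refine Finset.sum_congr rfl fun i _ => Finset.sum_congr rfl fun j _ => ?_
  rw [mul_comm, ← smul_eq_mul, ← map_smul, smul_single, smul_eq_mul, mul_one]

/-- If the rank-at-most-one matrices in `D ⊆ M_{2×n}(ℂ)` form the subspace `β ⊗ ℂ²`, then
`dim D ≤ n` and `D^⊥` is spanned by its rank-at-most-one matrices. -/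
theorem stmt17 (n : ℕ) (hn : 2 ≤ n) (D : Submodule ℂ (Matrix (Fin 2) (Fin n) ℂ))
    (β : Fin n → ℂ) (hβ : β ≠ 0)
    (hD1 : {V | V ∈ D ∧ V.rank ≤ 1} =
      {M : Matrix (Fin 2) (Fin n) ℂ | ∃ ξ : Fin 2 → ℂ, M = vecMulVec ξ (star β)}) :
    Module.finrank ℂ D ≤ n ∧
    hsPerp (D : Set (Matrix (Fin 2) (Fin n) ℂ)) =
      Submodule.span ℂ
        {W | W ∈ hsPerp (D : Set (Matrix (Fin 2) (Fin n) ℂ)) ∧ W.rank ≤ 1} := by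
  have hD : ∀ V ∈ D, V.rank ≤ 1 → ∃ ξ : Fin 2 → ℂ, V = vecMulVec ξ (star β) :=
    fun V hV hr => hD1.le ⟨hV, hr⟩
  have hβD : ∀ ξ : Fin 2 → ℂ, vecMulVec ξ (star β) ∈ D := fun ξ => (hD1.ge ⟨ξ, rfl⟩).1
  refine ⟨finrank_le_of_rank_le_one hn hβ hD hβD, le_antisymm (fun W hW => ?_)
    (Submodule.span_le.2 fun W hW => hW.1)⟩
  by_contra hWspan
  obtain ⟨f, hf, hker⟩ := Submodule.exists_le_ker_of_notMem hWspan
  obtain ⟨P, hP⟩ := exists_hilbertSchmidt_repr f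
  refine hf ((hP W).trans (hW P ?_))
  refine mem_of_forall_vecMul_mem hβ hD hβD (exists_vecMul_eq_of_orthogonal fun ξ γ h => ?_)
  rw [← hP]
  exact hker (Submodule.subset_span ⟨h, rank_vecMulVec_le _ _⟩)

end
end

section
/- Every completely entangled ℂ-linear subspace of M_{2×n}(ℂ) has dimension at most n − 1. -/
open Matrix Kronecker
open scoped ComplexOrder

noncomputable section

/-- A matrix of the form `a bᵀ` whose rank is not one vanishes. -/
theorem eq_zero_of_eq_vecMulVec {m n : Type*} [Fintype m] [Fintype n]
    {V : Matrix m n ℂ} (hV : V.rank ≠ 1) {a : m → ℂ} {b : n → ℂ} (h : V = vecMulVec a b) :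
    V = 0 := by
  have hle : V.rank ≤ 1 := h ▸ rank_vecMulVec_le a b
  have h0 : V.rank = 0 := by omega
  rw [Matrix.rank, Submodule.finrank_eq_zero, LinearMap.range_eq_bot] at h0
  exact Matrix.mulVec_injective (funext fun v => by simpa using LinearMap.congr_fun h0 v)

/-- Over an algebraically closed field, two linear maps `V → W` with `V ≠ 0`, the first one
bijective, are proportional at some nonzero vector. -/
theorem LinearEquiv.exists_ne_zero_apply_eq_smul {K V W : Type*} [Field K] [IsAlgClosed K]
    [AddCommGroup V] [Module K V] [FiniteDimensional K V] [Nontrivial V]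
    [AddCommGroup W] [Module K W] (f : V ≃ₗ[K] W) (g : V →ₗ[K] W) :
    ∃ v : V, v ≠ 0 ∧ ∃ c : K, g v = c • f v := by
  obtain ⟨c, hc⟩ := Module.End.exists_eigenvalue (f.symm.toLinearMap ∘ₗ g)
  obtain ⟨v, hv⟩ := hc.exists_hasEigenvector
  refine ⟨v, hv.2, c, ?_⟩
  have h := congrArg f hv.apply_eq_smul
  simpa using h

/-- Every completely entangled subspace of `M_{2×n}(ℂ)` has dimension at most `n - 1`. -/
theorem stmt18 (n : ℕ) (D : Submodule ℂ (Matrix (Fin 2) (Fin n) ℂ))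
    (hD : ∀ V ∈ D, V.rank ≠ 1) :
    Module.finrank ℂ D ≤ n - 1 := by
  let row (i : Fin 2) : D →ₗ[ℂ] (Fin n → ℂ) :=
    (LinearMap.proj i : (Fin 2 → Fin n → ℂ) →ₗ[ℂ] (Fin n → ℂ)) ∘ₗ D.subtype
  have hinj : Function.Injective (row 0) := by
    rw [← LinearMap.ker_eq_bot, LinearMap.ker_eq_bot']
    intro V hV
    have hV0 : V.1 0 = 0 := hV
    refine Subtype.ext (eq_zero_of_eq_vecMulVec (hD V V.2) (a := ![0, 1]) (b := V.1 1) ?_)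
    ext i j
    fin_cases i <;> simp [vecMulVec_apply, hV0]
  have hle : Module.finrank ℂ D ≤ n := by
    simpa using LinearMap.finrank_le_finrank_of_injective hinj
  by_contra hlt
  have hfin : Module.finrank ℂ D = n := by omega
  have : Nontrivial D := Module.nontrivial_of_finrank_pos (R := ℂ) (by omega)
  obtain ⟨V, hV, c, hc⟩ := LinearEquiv.exists_ne_zero_apply_eq_smul
    (LinearEquiv.ofInjectiveOfFinrankEq (row 0) hinj (by simpa using hfin)) (row 1)
  have hV1 : V.1 1 = c • V.1 0 := hc
  refine hV (Subtype.ext (eq_zero_of_eq_vecMulVec (hD V V.2) (a := ![1, c]) (b := V.1 0) ?_))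
  ext i j
  fin_cases i <;> simp [vecMulVec_apply, hV1]

end
end
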